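/- Let 𝒳, 𝒴 be nonempty finite types, K ≥ 1, p a joint pmf on 𝒳 × 𝒴 with p(x,y) > 0 whenever p_X(x) > 0 and p_Y(y) > 0, and P_C(·|x) a pmf on {1,…,K} for each x with P_C(c|x) > 0 for every c and every x with p_X(x) > 0. Let 𝒴_1,…,𝒴_K ⊆ 𝒴 be pairwise disjoint nonempty subsets with p_Y(y) > 0 on ⋃_i 𝒴_i such that, for some ε₁, ε₂ ≥ 0, KL( P_C(·|x) ‖ P_C(·|x;(𝒴_i)) ) ≤ ε₁ and KL( p_Y(·|𝒴_c) ‖ p_Y(·|x,𝒴_c) ) ≤ ε₂ for all x with p_X(x) > 0 and all c ∈ {1,…,K}. Let f_X : 𝒳 → ℝ^d, f_Y : 𝒴 → ℝ^d, τ > 0, and Δ ≥ 0 satisfy |(1/τ)⟪f_X(x), f_Y(y)⟫ − ln( p(x,y)/(p_X(x) p_Y(y)) )| ≤ Δ for every x with p_X(x) > 0 and every y with p_Y(y) > 0. Let h*(x)_c = ln P_C(c|x). Then there exist a matrix W ∈ ℝ^{d×K} and a vector b ∈ ℝ^K such that L_sup(x ↦ Wᵀ f_X(x) + b) − L_sup(h*)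 ≤ ε₁ + ε₂ + 2Δ. -/

import Mathlib

open Finset

/-- `q` is a probability mass function on the finite type `S`. -/
def IsPmf {S : Type*} [Fintype S] (q : S → ℝ) : Prop :=
  (∀ s, 0 ≤ q s) ∧ ∑ s, q s = 1

/-- Kullback–Leibler divergence `KL(q‖r) = ∑_{s : q s > 0} q s · ln (q s / r s)`. -/
noncomputable def KLdiv {S : Type*} [Fintype S] (q r : S → ℝ) : ℝ :=
  ∑ s ∈ Finset.univ.filter (fun s => 0 < q s), q s * Real.log (q s / r s)

/-- Log-softmax of `z : ℝ^K` at index `c`. -/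
noncomputable def logSoftmax {K : ℕ} (z : Fin K → ℝ) (c : Fin K) : ℝ :=
  Real.log (Real.exp (z c) / ∑ i, Real.exp (z i))

/-- Supervised softmax cross-entropy loss
`L_sup(h) = −∑_x ∑_c p_X(x) P_C(c|x) σ_c(h(x))`. -/
noncomputable def Lsup {𝒳 : Type*} [Fintype 𝒳] {K : ℕ}
    (pX : 𝒳 → ℝ) (PC : 𝒳 → Fin K → ℝ) (h : 𝒳 → Fin K → ℝ) : ℝ :=
  -∑ x, ∑ c, pX x * PC x c * logSoftmax (h x) c

/-- Marginal of the joint pmf `p` on the first coordinate: `p_X(x) = ∑_y p(x,y)`. -/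
noncomputable def margX {𝒳 𝒴 : Type*} [Fintype 𝒴] (p : 𝒳 × 𝒴 → ℝ) (x : 𝒳) : ℝ :=
  ∑ y, p (x, y)

/-- Marginal of the joint pmf `p` on the second coordinate: `p_Y(y) = ∑_x p(x,y)`. -/
noncomputable def margY {𝒳 𝒴 : Type*} [Fintype 𝒳] (p : 𝒳 × 𝒴 → ℝ) (y : 𝒴) : ℝ :=
  ∑ x, p (x, y)

/-- The classifier `h̄^g` induced by a similarity `g : 𝒳 → 𝒴 → ℝ` and disjoint class
sets `Y c ⊆ 𝒴`: `h̄^g(x)_c = ∑_{y∈Y c} p_Y(y|Y c) g(x,y) + ln P_Y(Y c)`. -/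
noncomputable def inducedClassifier {𝒳 𝒴 : Type*} [Fintype 𝒳] [Fintype 𝒴] {K : ℕ}
    (p : 𝒳 × 𝒴 → ℝ) (Y : Fin K → Finset 𝒴) (g : 𝒳 → 𝒴 → ℝ) (x : 𝒳) (c : Fin K) : ℝ :=
  ∑ y ∈ Y c, (margY p y / ∑ y' ∈ Y c, margY p y') * g x y
    + Real.log (∑ y' ∈ Y c, margY p y')

theorem logSoftmax_eq_sub_log_sum_exp {K : ℕ} (z : Fin K → ℝ) (c : Fin K) :
    logSoftmax z c = z c - Real.log (∑ i, Real.exp (z i)) := by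
  have hpos : 0 < ∑ i, Real.exp (z i) :=
    Finset.sum_pos (fun i _ => Real.exp_pos _) ⟨c, Finset.mem_univ c⟩
  rw [logSoftmax, Real.log_div (Real.exp_pos _).ne' hpos.ne', Real.log_exp]

theorem logSoftmax_log_of_isPmf {K : ℕ} {P : Fin K → ℝ} (hP : IsPmf P) (hpos : ∀ c, 0 < P c)
    (c : Fin K) : logSoftmax (fun i => Real.log (P i)) c = Real.log (P c) := by
  simp [logSoftmax_eq_sub_log_sum_exp, Real.exp_log (hpos _), hP.2]

/-- Gibbs' inequality for positive weights on a finite set. -/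
theorem sum_mul_log_div_nonneg {ι : Type*} (s : Finset ι) (a b : ι → ℝ)
    (ha : ∀ i ∈ s, 0 < a i) (hb : ∀ i ∈ s, 0 < b i) (hab : ∑ i ∈ s, b i ≤ ∑ i ∈ s, a i) :
    0 ≤ ∑ i ∈ s, a i * Real.log (a i / b i) := by
  have h : ∑ i ∈ s, (a i - b i) ≤ ∑ i ∈ s, a i * Real.log (a i / b i) := by
    refine Finset.sum_le_sum fun i hi => ?_
    have hai := ha i hi
    have hbi := hb i hi
    have hle := mul_le_mul_of_nonneg_left
      (Real.one_sub_inv_le_log_of_pos (div_pos hai hbi)) hai.le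
    refine le_trans (le_of_eq ?_) hle
    field_simp
  rw [Finset.sum_sub_distrib] at h
  linarith

theorem KLdiv_ite_mem {S : Type*} [Fintype S] [DecidableEq S] (s : Finset S) (a b : S → ℝ)
    (ha : ∀ y ∈ s, 0 < a y) :
    KLdiv (fun y => if y ∈ s then a y else 0) (fun y => if y ∈ s then b y else 0)
      = ∑ y ∈ s, a y * Real.log (a y / b y) := by
  have hs : Finset.univ.filter (fun y => 0 < if y ∈ s then a y else 0) = s := by
    ext y
    by_cases hy : y ∈ s <;> simp [hy, ha]
  rw [KLdiv, hs]
  exact Finset.sum_congr rfl fun y hy => by simp [hy]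

theorem sum_normalized_eq_one {ι : Type*} {s : Finset ι} (hs : s.Nonempty) {a : ι → ℝ}
    (ha : ∀ y ∈ s, 0 < a y) : ∑ y ∈ s, a y / ∑ y' ∈ s, a y' = 1 := by
  rw [← Finset.sum_div]
  exact div_self (Finset.sum_pos ha hs).ne'

/-- The relative entropy of normalized restrictions, in terms of the unnormalized weights. -/
theorem KLdiv_normalized_eq {S : Type*} [Fintype S] [DecidableEq S] {s : Finset S}
    (hs : s.Nonempty) {a b : S → ℝ} (ha : ∀ y ∈ s, 0 < a y) (hb : ∀ y ∈ s, 0 < b y) :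
    KLdiv (fun y => if y ∈ s then a y / ∑ y' ∈ s, a y' else 0)
        (fun y => if y ∈ s then b y / ∑ y' ∈ s, b y' else 0)
      = Real.log (∑ y ∈ s, b y) - Real.log (∑ y ∈ s, a y)
        - ∑ y ∈ s, (a y / ∑ y' ∈ s, a y') * Real.log (b y / a y) := by
  have hA := Finset.sum_pos ha hs
  have hB := Finset.sum_pos hb hs
  rw [KLdiv_ite_mem s (fun y => a y / ∑ y' ∈ s, a y') (fun y => b y / ∑ y' ∈ s, b y')
    fun y hy => div_pos (ha y hy) hA]
  have hterm : ∀ y ∈ s, (a y / ∑ y' ∈ s, a y') *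
      Real.log ((a y / ∑ y' ∈ s, a y') / (b y / ∑ y' ∈ s, b y'))
      = (a y / ∑ y' ∈ s, a y') * (Real.log (∑ y ∈ s, b y) - Real.log (∑ y ∈ s, a y))
        - (a y / ∑ y' ∈ s, a y') * Real.log (b y / a y) := by
    intro y hy
    have hay := (ha y hy).ne'
    have hby := (hb y hy).ne'
    rw [Real.log_div (div_ne_zero hay hA.ne') (div_ne_zero hby hB.ne'),
      Real.log_div hay hA.ne', Real.log_div hby hB.ne', Real.log_div hby hay]
    ring
  rw [Finset.sum_congr rfl hterm, Finset.sum_sub_distrib, ← Finset.sum_mul,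
    sum_normalized_eq_one hs ha, one_mul]

theorem KLdiv_normalized_nonneg {S : Type*} [Fintype S] [DecidableEq S] {s : Finset S}
    (hs : s.Nonempty) {a b : S → ℝ} (ha : ∀ y ∈ s, 0 < a y) (hb : ∀ y ∈ s, 0 < b y) :
    0 ≤ KLdiv (fun y => if y ∈ s then a y / ∑ y' ∈ s, a y' else 0)
        (fun y => if y ∈ s then b y / ∑ y' ∈ s, b y' else 0) := by
  have hA := Finset.sum_pos ha hs
  have hB := Finset.sum_pos hb hs
  rw [KLdiv_ite_mem s (fun y => a y / ∑ y' ∈ s, a y') (fun y => b y / ∑ y' ∈ s, b y')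
    fun y hy => div_pos (ha y hy) hA]
  refine sum_mul_log_div_nonneg s _ _ (fun y hy => div_pos (ha y hy) hA)
    (fun y hy => div_pos (hb y hy) hB) ?_
  rw [sum_normalized_eq_one hs ha, sum_normalized_eq_one hs hb]

theorem abs_sum_mul_sub_sum_mul_le {ι : Type*} {s : Finset ι} {w u v : ι → ℝ} {δ : ℝ}
    (hw : ∀ i ∈ s, 0 ≤ w i) (hw1 : ∑ i ∈ s, w i = 1) (huv : ∀ i ∈ s, |u i - v i| ≤ δ) :
    |∑ i ∈ s, w i * u i - ∑ i ∈ s, w i * v i| ≤ δ := by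
  rw [← Finset.sum_sub_distrib]
  calc |∑ i ∈ s, (w i * u i - w i * v i)|
      ≤ ∑ i ∈ s, |w i * u i - w i * v i| := Finset.abs_sum_le_sum_abs _ _
    _ ≤ ∑ i ∈ s, w i * δ := by
        refine Finset.sum_le_sum fun i hi => ?_
        rw [← mul_sub, abs_mul, abs_of_nonneg (hw i hi)]
        exact mul_le_mul_of_nonneg_left (huv i hi) (hw i hi)
    _ = δ := by rw [← Finset.sum_mul, hw1, one_mul]

theorem sum_mul_le_of_isPmf {ι : Type*} [Fintype ι] {w u : ι → ℝ} {C : ℝ} (hw : IsPmf w)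
    (hu : ∀ i, 0 < w i → u i ≤ C) : ∑ i, w i * u i ≤ C := by
  calc ∑ i, w i * u i ≤ ∑ i, w i * C := by
        refine Finset.sum_le_sum fun i _ => ?_
        rcases (hw.1 i).eq_or_lt with h | h
        · simp [← h]
        · exact mul_le_mul_of_nonneg_left (hu i h) h.le
    _ = C := by rw [← Finset.sum_mul, hw.2, one_mul]

theorem isPmf_margX {𝒳 𝒴 : Type*} [Fintype 𝒳] [Fintype 𝒴] {p : 𝒳 × 𝒴 → ℝ} (hp : IsPmf p) :
    IsPmf (margX p) :=
  ⟨fun _ => Finset.sum_nonneg fun _ _ => hp.1 _, by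
    simpa only [margX, Fintype.sum_prod_type] using hp.2⟩

/-- Logits close to the logarithms of unnormalized class weights `q` have excess conditional
cross-entropy controlled by the relative entropy to the normalization of `q`. -/
theorem sum_mul_log_sub_logSoftmax_le {K : ℕ} {P q z : Fin K → ℝ} {ε δ : ℝ}
    (hP : IsPmf P) (hPpos : ∀ c, 0 < P c) (hq : ∀ c, 0 < q c)
    (hlow : ∀ c, Real.log (q c) - ε - δ ≤ z c) (hup : ∀ c, z c ≤ Real.log (q c) + δ) :
    ∑ c, P c * (Real.log (P c) - logSoftmax z c)
      ≤ KLdiv P (fun c => q c / ∑ i, q i) + ε + 2 * δ := by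
  have hKL : KLdiv P (fun c => q c / ∑ i, q i)
      = ∑ c, P c * Real.log (P c / (q c / ∑ i, q i)) := by
    simp [KLdiv, hPpos]
  have hterm : ∀ c, P c * (Real.log (P c) - logSoftmax z c)
      ≤ P c * Real.log (P c / (q c / ∑ i, q i)) + P c * (ε + 2 * δ) := by
    intro c
    have hQ : 0 < ∑ i, q i := Finset.sum_pos (fun i _ => hq i) ⟨c, Finset.mem_univ c⟩
    have hE : 0 < ∑ i, Real.exp (z i) :=
      Finset.sum_pos (fun i _ => Real.exp_pos _) ⟨c, Finset.mem_univ c⟩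
    have hlse : Real.log (∑ i, Real.exp (z i)) ≤ Real.log (∑ i, q i) + δ := by
      rw [Real.log_le_iff_le_exp hE, Real.exp_add, Real.exp_log hQ, Finset.sum_mul]
      refine Finset.sum_le_sum fun i _ => ?_
      calc Real.exp (z i) ≤ Real.exp (Real.log (q i) + δ) := Real.exp_le_exp.2 (hup i)
        _ = q i * Real.exp δ := by rw [Real.exp_add, Real.exp_log (hq i)]
    rw [← mul_add]
    refine mul_le_mul_of_nonneg_left ?_ (hPpos c).le
    rw [logSoftmax_eq_sub_log_sum_exp, Real.log_div (hPpos c).ne' (div_pos (hq c) hQ).ne',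
      Real.log_div (hq c).ne' hQ.ne']
    linarith [hlow c]
  calc ∑ c, P c * (Real.log (P c) - logSoftmax z c)
      ≤ ∑ c, (P c * Real.log (P c / (q c / ∑ i, q i)) + P c * (ε + 2 * δ)) :=
        Finset.sum_le_sum fun c _ => hterm c
    _ = KLdiv P (fun c => q c / ∑ i, q i) + ε + 2 * δ := by
        rw [Finset.sum_add_distrib, ← Finset.sum_mul, hP.2, hKL]
        ring

theorem Lsup_sub_Lsup {𝒳 : Type*} [Fintype 𝒳] {K : ℕ} (pX : 𝒳 → ℝ) (PC : 𝒳 → Fin K → ℝ)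
    (h h' : 𝒳 → Fin K → ℝ) :
    Lsup pX PC h - Lsup pX PC h'
      = ∑ x, pX x * ∑ c, PC x c * (logSoftmax (h' x) c - logSoftmax (h x) c) := by
  simp only [Lsup, mul_sub, Finset.sum_sub_distrib, Finset.mul_sum, mul_assoc]
  ring

/-- The classifier induced by the pointwise mutual information has logits
`ln P_Y(Y c|x) - KL(p_Y(·|Y c) ‖ p_Y(·|x, Y c))`. -/
theorem inducedClassifier_pmi {𝒳 𝒴 : Type*} [Fintype 𝒳] [Fintype 𝒴] [DecidableEq 𝒴] {K : ℕ}
    {p : 𝒳 × 𝒴 → ℝ} {Y : Fin K → Finset 𝒴} {x : 𝒳} {c : Fin K} (hYne : (Y c).Nonempty)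
    (hx : 0 < margX p x) (hY : ∀ y ∈ Y c, 0 < margY p y) (hpos : ∀ y ∈ Y c, 0 < p (x, y)) :
    inducedClassifier p Y (fun x y => Real.log (p (x, y) / (margX p x * margY p y))) x c
      = Real.log (∑ y ∈ Y c, p (x, y) / margX p x)
        - KLdiv (fun y => if y ∈ Y c then margY p y / ∑ y' ∈ Y c, margY p y' else 0)
            (fun y => if y ∈ Y c then
              (p (x, y) / margX p x) / ∑ y' ∈ Y c, p (x, y') / margX p x else 0) := by
  rw [KLdiv_normalized_eq (b := fun y => p (x, y) / margX p x) hYne hY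
    fun y hy => div_pos (hpos y hy) hx]
  simp only [inducedClassifier, div_div]
  ring

/-- Similarities that are uniformly close on a class induce close logits for it. -/
theorem abs_inducedClassifier_sub_le {𝒳 𝒴 : Type*} [Fintype 𝒳] [Fintype 𝒴] {K : ℕ}
    {p : 𝒳 × 𝒴 → ℝ} {Y : Fin K → Finset 𝒴} {g g' : 𝒳 → 𝒴 → ℝ} {x : 𝒳} {c : Fin K} {δ : ℝ}
    (hYne : (Y c).Nonempty) (hY : ∀ y ∈ Y c, 0 < margY p y)
    (hg : ∀ y ∈ Y c, |g x y - g' x y| ≤ δ) :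
    |inducedClassifier p Y g x c - inducedClassifier p Y g' x c| ≤ δ := by
  rw [inducedClassifier, inducedClassifier, add_sub_add_right_eq_sub]
  exact abs_sum_mul_sub_sum_mul_le
    (fun y hy => (div_pos (hY y hy) (Finset.sum_pos hY hYne)).le)
    (sum_normalized_eq_one hYne hY) hg

/-- A similarity that is bilinear in the features induces a linear classifier. -/
theorem inducedClassifier_inner {𝒳 𝒴 : Type*} [Fintype 𝒳] [Fintype 𝒴] {K d : ℕ}
    (p : 𝒳 × 𝒴 → ℝ) (Y : Fin K → Finset 𝒴) (fX : 𝒳 → Fin d → ℝ) (fY : 𝒴 → Fin d → ℝ)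
    (t : ℝ) (x : 𝒳) (c : Fin K) :
    inducedClassifier p Y (fun x y => t * ∑ j, fX x j * fY y j) x c
      = (∑ j, (∑ y ∈ Y c, (margY p y / ∑ y' ∈ Y c, margY p y') * (t * fY y j)) * fX x j)
        + Real.log (∑ y' ∈ Y c, margY p y') := by
  rw [inducedClassifier]
  simp only [Finset.sum_mul, Finset.mul_sum]
  rw [Finset.sum_comm]
  congr 1
  exact Finset.sum_congr rfl fun j _ => Finset.sum_congr rfl fun y _ => by ring

/-- **(Theorem 2: excess risk of the best linear classifier via the PMI gap.)** Under the
near-optimality assumptions on the class sets (KL terms bounded by `ε₁`, `ε₂`) and a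
uniform gap `Δ` between the scaled inner-product similarity and the pointwise mutual
information, there exist a weight matrix `W : ℝ^{d×K}` and a bias `b : ℝ^K` such that the
linear classifier `x ↦ Wᵀ f_X(x) + b` has excess supervised risk over the optimal
classifier `h*(x)_c = ln P_C(c|x)` at most `ε₁ + ε₂ + 2Δ`. -/
theorem excess_risk_linear_classifier_of_pmi_gap
    {𝒳 𝒴 : Type*} [Fintype 𝒳] [Fintype 𝒴] [Nonempty 𝒳] [Nonempty 𝒴] [DecidableEq 𝒴]
    {K d : ℕ} (hK : 1 ≤ K)
    (p : 𝒳 × 𝒴 → ℝ) (hp : IsPmf p)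
    (hppos : ∀ x y, 0 < margX p x → 0 < margY p y → 0 < p (x, y))
    (PC : 𝒳 → Fin K → ℝ) (hPC : ∀ x, IsPmf (PC x))
    (hPCpos : ∀ x, 0 < margX p x → ∀ c, 0 < PC x c)
    (Y : Fin K → Finset 𝒴)
    (hdisj : ∀ i j, i ≠ j → Disjoint (Y i) (Y j))
    (hYne : ∀ i, (Y i).Nonempty)
    (hpYpos : ∀ i, ∀ y ∈ Y i, 0 < margY p y)
    (ε₁ ε₂ : ℝ) (hε₁ : 0 ≤ ε₁) (hε₂ : 0 ≤ ε₂)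
    (hKL₁ : ∀ x, 0 < margX p x →
      KLdiv (PC x)
        (fun c => (∑ y ∈ Y c, p (x, y) / margX p x)
          / ∑ i, ∑ y ∈ Y i, p (x, y) / margX p x) ≤ ε₁)
    (hKL₂ : ∀ x, 0 < margX p x → ∀ c : Fin K,
      KLdiv
        (fun y => if y ∈ Y c then margY p y / ∑ y' ∈ Y c, margY p y' else 0)
        (fun y => if y ∈ Y c then
            (p (x, y) / margX p x) / ∑ y' ∈ Y c, p (x, y') / margX p x
          else 0) ≤ ε₂)
    (fX : 𝒳 → Fin d → ℝ) (fY : 𝒴 → Fin d → ℝ) (τ : ℝ) (hτ : 0 < τ)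
    (Δ : ℝ) (hΔ : 0 ≤ Δ)
    (hgap : ∀ x, 0 < margX p x → ∀ y, 0 < margY p y →
      |(1 / τ) * (∑ j, fX x j * fY y j)
        - Real.log (p (x, y) / (margX p x * margY p y))| ≤ Δ) :
    ∃ (W : Matrix (Fin d) (Fin K) ℝ) (b : Fin K → ℝ),
      Lsup (margX p) PC (fun x c => (∑ j, W j c * fX x j) + b c)
        - Lsup (margX p) PC (fun x c => Real.log (PC x c))
      ≤ ε₁ + ε₂ + 2 * Δ := by
  refine ⟨fun j c => ∑ y ∈ Y c, (margY p y / ∑ y' ∈ Y c, margY p y') * (1 / τ * fY y j),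
    fun c => Real.log (∑ y ∈ Y c, margY p y), ?_⟩
  simp only [← inducedClassifier_inner p Y fX fY]
  rw [Lsup_sub_Lsup]
  refine sum_mul_le_of_isPmf (isPmf_margX hp) fun x hx => ?_
  simp only [logSoftmax_log_of_isPmf (hPC x) (hPCpos x hx)]
  have hpxy : ∀ c, ∀ y ∈ Y c, 0 < p (x, y) := fun c y hy => hppos x y hx (hpYpos c y hy)
  have hcond : ∀ c, ∀ y ∈ Y c, 0 < p (x, y) / margX p x := fun c y hy =>
    div_pos (hpxy c y hy) hx
  have hclose := fun c => abs_le.1 (abs_inducedClassifier_sub_le (hYne c) (hpYpos c)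
    (g := fun x y => 1 / τ * ∑ j, fX x j * fY y j)
    (g' := fun x y => Real.log (p (x, y) / (margX p x * margY p y))) (x := x)
    fun y hy => hgap x hx y (hpYpos c y hy))
  have hpmi := fun c => inducedClassifier_pmi (hYne c) hx (hpYpos c) (hpxy c)
  have hKLnonneg := fun c => KLdiv_normalized_nonneg (hYne c) (hpYpos c) (hcond c)
  have hmain := sum_mul_log_sub_logSoftmax_le (ε := ε₂) (δ := Δ)
    (z := inducedClassifier p Y (fun x y => 1 / τ * ∑ j, fX x j * fY y j) x)
    (hPC x) (hPCpos x hx)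
    (fun c => Finset.sum_pos (hcond c) (hYne c))
    (fun c => by linarith [(hclose c).1, hpmi c, hKL₂ x hx c])
    (fun c => by linarith [(hclose c).2, hpmi c, hKLnonneg c])
  linarith [hKL₁ x hx]
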